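/- Let m ≥ 1/2 and let X and Y be independent random variables, each Gamma distributed with shape m and scale 1/m (so E[X] = E[Y] = 1). Then P(X·Y ≤ γ) / P(X ≤ γ) → ∞ as γ → 0+. -/

import Mathlib

open MeasureTheory ProbabilityTheory Filter Set Topology

/-- Gamma density with shape `m` and scale `θ`. -/
noncomputable def gammaDen (m θ z : ℝ) : ℝ :=
  if 0 < z then z ^ (m - 1) * Real.exp (-z / θ) / (Real.Gamma m * θ ^ m) else 0

theorem gammaDen_eq_zero_of_nonpos {m θ z : ℝ} (hz : z ≤ 0) : gammaDen m θ z = 0 :=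
  if_neg hz.not_gt

@[fun_prop]
theorem measurable_gammaDen (m θ : ℝ) : Measurable (gammaDen m θ) := by
  unfold gammaDen
  exact Measurable.ite measurableSet_Ioi (by fun_prop) measurable_const

theorem gammaDen_le {m θ z : ℝ} (hm : 0 < m) (hθ : 0 < θ) (hz : 0 < z) :
    gammaDen m θ z ≤ (Real.Gamma m * θ ^ m)⁻¹ * z ^ (m - 1) := by
  have hΓ := Real.Gamma_pos_of_pos hm
  have hexp : Real.exp (-z / θ) ≤ 1 :=
    Real.exp_le_one_iff.2 (div_nonpos_of_nonpos_of_nonneg (by linarith) hθ.le)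
  rw [gammaDen, if_pos hz, div_eq_inv_mul]
  gcongr
  exact mul_le_of_le_one_right (by positivity) hexp

theorem le_gammaDen {m θ z : ℝ} (hm : 0 < m) (hθ : 0 < θ) (hz : 0 < z) (hz1 : z ≤ 1) :
    Real.exp (-1 / θ) * (Real.Gamma m * θ ^ m)⁻¹ * z ^ (m - 1) ≤ gammaDen m θ z := by
  have hΓ := Real.Gamma_pos_of_pos hm
  have hexp : Real.exp (-1 / θ) ≤ Real.exp (-z / θ) := by gcongr
  rw [gammaDen, if_pos hz, mul_comm (z ^ _), div_eq_mul_inv (_ * _),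
    mul_right_comm (Real.exp (-z / θ))]
  gcongr

theorem setLIntegral_Ioc_ofReal_const_mul_rpow {m c t : ℝ} (hm : 0 < m) (hc : 0 ≤ c)
    (ht : 0 ≤ t) :
    ∫⁻ x in Ioc 0 t, ENNReal.ofReal (c * x ^ (m - 1)) = ENNReal.ofReal (c / m * t ^ m) := by
  have hint : IntervalIntegrable (fun x : ℝ => c * x ^ (m - 1)) volume 0 t :=
    (intervalIntegral.intervalIntegrable_rpow' (by linarith)).const_mul c
  rw [← ofReal_integral_eq_lintegral_ofReal hint.1, ← intervalIntegral.integral_of_le ht,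
    intervalIntegral.integral_const_mul, integral_rpow (Or.inl (by linarith)), sub_add_cancel,
    Real.zero_rpow hm.ne', sub_zero, mul_div_assoc', div_mul_eq_mul_div]
  filter_upwards [ae_restrict_mem measurableSet_Ioc] with x hx
  exact mul_nonneg hc (Real.rpow_nonneg hx.1.le _)

theorem setLIntegral_Ioc_ofReal_const_mul_inv {c a : ℝ} (hc : 0 ≤ c) (ha : 0 < a)
    (ha1 : a ≤ 1) :
    ∫⁻ x in Ioc a 1, ENNReal.ofReal (c * x⁻¹) = ENNReal.ofReal (c * -Real.log a) := by
  have hint : IntervalIntegrable (fun x : ℝ => c * x⁻¹) volume a 1 := by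
    refine (intervalIntegral.intervalIntegrable_inv (fun x hx => ?_) continuousOn_id).const_mul c
    rw [uIcc_of_le ha1] at hx
    exact (ha.trans_le hx.1).ne'
  rw [← ofReal_integral_eq_lintegral_ofReal hint.1, ← intervalIntegral.integral_of_le ha1,
    intervalIntegral.integral_const_mul, integral_inv_of_pos ha one_pos, one_div, Real.log_inv]
  filter_upwards [ae_restrict_mem measurableSet_Ioc] with x hx
  exact mul_nonneg hc (inv_nonneg.2 (ha.trans hx.1).le)

section PowerDensity

variable {f : ℝ → ENNReal} {m c : ℝ}

theorem withDensity_Iic_le_of_le_rpow (hm : 0 < m) (hc : 0 ≤ c) (hf0 : ∀ z ≤ 0, f z = 0)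
    (hf : ∀ z, 0 < z → f z ≤ ENNReal.ofReal (c * z ^ (m - 1))) {t : ℝ} (ht : 0 ≤ t) :
    volume.withDensity f (Iic t) ≤ ENNReal.ofReal (c / m * t ^ m) := by
  rw [withDensity_apply _ measurableSet_Iic, ← Iic_union_Ioc_eq_Iic ht,
    lintegral_union measurableSet_Ioc (Iic_disjoint_Ioc le_rfl),
    setLIntegral_congr_fun measurableSet_Iic (fun z hz => hf0 z hz), lintegral_zero, zero_add,
    ← setLIntegral_Ioc_ofReal_const_mul_rpow hm hc ht]
  exact setLIntegral_mono' measurableSet_Ioc fun z hz => hf z hz.1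

theorem le_withDensity_Iic_of_rpow_le (hm : 0 < m) (hc : 0 ≤ c)
    (hf : ∀ z, 0 < z → z ≤ 1 → ENNReal.ofReal (c * z ^ (m - 1)) ≤ f z) {t : ℝ}
    (ht : 0 ≤ t) (ht1 : t ≤ 1) :
    ENNReal.ofReal (c / m * t ^ m) ≤ volume.withDensity f (Iic t) := by
  rw [withDensity_apply _ measurableSet_Iic, ← setLIntegral_Ioc_ofReal_const_mul_rpow hm hc ht]
  exact (setLIntegral_mono' measurableSet_Ioc fun z hz => hf z hz.1 (hz.2.trans ht1)).trans
    (lintegral_mono_set Ioc_subset_Iic_self)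

theorem le_prod_withDensity_of_rpow_le (hfm : Measurable f)
    [SFinite (volume.withDensity f)] (hm : 0 < m) (hc : 0 ≤ c)
    (hf : ∀ z, 0 < z → z ≤ 1 → ENNReal.ofReal (c * z ^ (m - 1)) ≤ f z) {γ : ℝ}
    (hγ : 0 < γ) (hγ1 : γ ≤ 1) :
    ENNReal.ofReal (c ^ 2 / m * γ ^ m * -Real.log γ) ≤
      (volume.withDensity f).prod (volume.withDensity f) {p | p.1 * p.2 ≤ γ} := by
  rw [Measure.prod_apply_symm (measurableSet_le (by fun_prop) measurable_const)]
  have hmeas : Measurable fun y : ℝ => ENNReal.ofReal (c / m * (γ / y) ^ m) := by fun_prop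
  calc
    _ = ∫⁻ y in Ioc γ 1, ENNReal.ofReal (c ^ 2 / m * γ ^ m * y⁻¹) :=
      (setLIntegral_Ioc_ofReal_const_mul_inv (by positivity) hγ hγ1).symm
    _ ≤ ∫⁻ y in Ioc γ 1, (f * fun y => ENNReal.ofReal (c / m * (γ / y) ^ m)) y := by
      refine setLIntegral_mono' measurableSet_Ioc fun y hy => ?_
      have hy0 : 0 < y := hγ.trans hy.1
      have hprod : c ^ 2 / m * γ ^ m * y⁻¹ = c * y ^ (m - 1) * (c / m * (γ / y) ^ m) := by
        rw [Real.div_rpow hγ.le hy0.le, Real.rpow_sub_one hy0.ne']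
        have := (Real.rpow_pos_of_pos hy0 m).ne'
        field_simp
      rw [hprod, ENNReal.ofReal_mul (by positivity), Pi.mul_apply]
      gcongr
      exact hf y hy0 hy.2
    _ = ∫⁻ y in Ioc γ 1, ENNReal.ofReal (c / m * (γ / y) ^ m) ∂(volume.withDensity f) :=
      (setLIntegral_withDensity_eq_setLIntegral_mul _ hfm hmeas measurableSet_Ioc).symm
    _ ≤ ∫⁻ y in Ioc γ 1, volume.withDensity f ((fun x => (x, y)) ⁻¹' {p | p.1 * p.2 ≤ γ})
          ∂(volume.withDensity f) := by
      refine setLIntegral_mono' measurableSet_Ioc fun y hy => ?_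
      have hy0 : 0 < y := hγ.trans hy.1
      refine (le_withDensity_Iic_of_rpow_le hm hc hf (by positivity)
        ((div_le_one hy0).2 hy.1.le)).trans (measure_mono fun x hx => ?_)
      exact (le_div_iff₀ hy0).1 hx
    _ ≤ _ := setLIntegral_le_lintegral _ _

end PowerDensity

/-- Paper's eq. (2) made precise: for mean-normalized Gamma (squared Nakagami-m) gains,
the product (dyadic) channel has a diverging ratio of deep-fade probabilities relative to
a single hop: `P(XY ≤ γ)/P(X ≤ γ) → ∞` as `γ → 0⁺`. -/
theorem dyadic_deep_fade_ratio_diverges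
    {Ωs : Type*} [MeasureSpace Ωs] [IsProbabilityMeasure (ℙ : Measure Ωs)]
    (m : ℝ) (hm : 1 / 2 ≤ m)
    (X Y : Ωs → ℝ) (hX : Measurable X) (hY : Measurable Y)
    (hindep : IndepFun X Y)
    (hlawX : Measure.map X ℙ =
      volume.withDensity (fun z => ENNReal.ofReal (gammaDen m (1 / m) z)))
    (hlawY : Measure.map Y ℙ =
      volume.withDensity (fun z => ENNReal.ofReal (gammaDen m (1 / m) z))) :
    Tendsto (fun γ : ℝ =>
        (ℙ {ω | X ω * Y ω ≤ γ}).toReal / (ℙ {ω | X ω ≤ γ}).toReal)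
      (𝓝[>] (0 : ℝ)) atTop := by
  have hm0 : 0 < m := by linarith
  have hθ : 0 < 1 / m := by positivity
  set f : ℝ → ENNReal := fun z => ENNReal.ofReal (gammaDen m (1 / m) z) with hf
  set C : ℝ := (Real.Gamma m * (1 / m) ^ m)⁻¹ with hC
  set c : ℝ := Real.exp (-1 / (1 / m)) * C with hc
  have hC0 : 0 < C := by
    have := Real.Gamma_pos_of_pos hm0
    positivity
  have hc0 : 0 < c := by positivity
  have hfm : Measurable f := by fun_prop
  have hf0 : ∀ z ≤ 0, f z = 0 := fun z hz => by simp [hf, gammaDen_eq_zero_of_nonpos hz]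
  have hupper : ∀ z, 0 < z → f z ≤ ENNReal.ofReal (C * z ^ (m - 1)) := fun z hz =>
    ENNReal.ofReal_le_ofReal (gammaDen_le hm0 hθ hz)
  have hlower : ∀ z, 0 < z → z ≤ 1 → ENNReal.ofReal (c * z ^ (m - 1)) ≤ f z := fun z hz hz1 =>
    ENNReal.ofReal_le_ofReal (le_gammaDen hm0 hθ hz hz1)
  have hlog : Tendsto (fun γ : ℝ => c ^ 2 / C * -Real.log γ) (𝓝[>] (0 : ℝ)) atTop :=
    (tendsto_neg_atBot_atTop.comp Real.tendsto_log_nhdsGT_zero).const_mul_atTop (by positivity)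
  refine tendsto_atTop_mono' _ ?_ hlog
  filter_upwards [Ioc_mem_nhdsGT (zero_lt_one' ℝ)] with γ hγ
  have hγm : 0 < γ ^ m := Real.rpow_pos_of_pos hγ.1 m
  have hX_eq : ℙ {ω | X ω ≤ γ} = volume.withDensity f (Iic γ) := by
    rw [← hlawX, Measure.map_apply hX measurableSet_Iic]
    rfl
  have hXY_eq : ℙ {ω | X ω * Y ω ≤ γ} =
      (volume.withDensity f).prod (volume.withDensity f) {p | p.1 * p.2 ≤ γ} := by
    have hjoint := (indepFun_iff_map_prod_eq_prod_map_map hX.aemeasurable hY.aemeasurable).1 hindep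
    rw [hlawX, hlawY] at hjoint
    rw [← hjoint, Measure.map_apply (hX.prodMk hY)
      (measurableSet_le (by fun_prop) measurable_const)]
    rfl
  have hXY_ge : c ^ 2 / m * γ ^ m * -Real.log γ ≤ (ℙ {ω | X ω * Y ω ≤ γ}).toReal := by
    refine (ENNReal.ofReal_le_iff_le_toReal (measure_ne_top _ _)).1 ?_
    rw [hXY_eq]
    exact le_prod_withDensity_of_rpow_le hfm hm0 hc0.le hlower hγ.1 hγ.2
  have hX_le : (ℙ {ω | X ω ≤ γ}).toReal ≤ C / m * γ ^ m := by
    refine ENNReal.toReal_le_of_le_ofReal (by positivity) ?_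
    rw [hX_eq]
    exact withDensity_Iic_le_of_le_rpow hm0 hC0.le hf0 hupper hγ.1.le
  have hX_pos : 0 < (ℙ {ω | X ω ≤ γ}).toReal := by
    refine lt_of_lt_of_le (b := c / m * γ ^ m) (by positivity) ?_
    refine (ENNReal.ofReal_le_iff_le_toReal (measure_ne_top _ _)).1 ?_
    rw [hX_eq]
    exact le_withDensity_Iic_of_rpow_le hm0 hc0.le hlower hγ.1.le hγ.2
  calc
    c ^ 2 / C * -Real.log γ = c ^ 2 / m * γ ^ m * -Real.log γ / (C / m * γ ^ m) := by
      field_simp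
    _ ≤ _ := div_le_div₀ ENNReal.toReal_nonneg hXY_ge hX_pos hX_le
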